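/- Let P₁, ..., P_n be orthogonal projections on a finite-dimensional complex Hilbert space and ψ a unit vector with (1/n) Σ_i ‖P_i ψ‖² = V. Suppose an extractor succeeds if all of t sequential measurements (with independently uniform indices i₁,...,i_t, each measurement projecting with P_{i_k} and renormalizing) succeed. Then the overall success probability, equal to (1/n^t) Σ_{i₁,...,i_t} ‖P_{i_t}⋯P_{i₁} ψ‖², is at least V^{2t−1}; in particular, if V is non-negligible (V ≥ 1/poly) then the extraction probability is at least 1/poly^{2t−1}, also non-negligible for constant t. -/

import Mathlib

open Finset

/-- Apply the projections `P (iv 0), P (iv 1), ..., P (iv (t-1))` to `ψ` in this order,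
so that the result is `P_{i_t} ⋯ P_{i_1} ψ`; by the chain rule for sequential projective
measurements, `‖seqApply P iv ψ‖²` is the probability that all `t` measurements succeed. -/
noncomputable def seqApply {E : Type*} [NormedAddCommGroup E] [InnerProductSpace ℂ E]
    {n t : ℕ} (P : Fin n → (E →ₗ[ℂ] E)) (iv : Fin t → Fin n) (ψ : E) : E :=
  (List.ofFn fun k => P (iv k)).foldl (fun v Q => Q v) ψ

section PositiveOperators

variable {𝕜 E : Type*} [RCLike 𝕜] [NormedAddCommGroup E] [InnerProductSpace 𝕜 E]

theorem LinearMap.IsPositive.pow {T : E →ₗ[𝕜] E} (hT : T.IsPositive) (k : ℕ) :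
    (T ^ k).IsPositive := by
  refine ⟨hT.isSymmetric.pow k, fun x => ?_⟩
  obtain ⟨j, rfl | rfl⟩ := Nat.even_or_odd' k
  · rw [two_mul, pow_add, Module.End.mul_apply, hT.isSymmetric.pow j]
    exact inner_self_nonneg
  · rw [show 2 * j + 1 = j + (1 + j) by ring, pow_add, pow_add, pow_one, Module.End.mul_apply,
      Module.End.mul_apply, hT.isSymmetric.pow j]
    exact hT.re_inner_nonneg_left _

theorem LinearMap.IsPositive.sum {ι : Type*} (s : Finset ι) {T : ι → E →ₗ[𝕜] E}
    (hT : ∀ i ∈ s, (T i).IsPositive) : (∑ i ∈ s, T i).IsPositive :=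
  Finset.sum_induction T LinearMap.IsPositive (fun _ _ => LinearMap.IsPositive.add)
    LinearMap.isPositive_zero hT

/-- The quadratic form of a symmetric idempotent is the squared norm of its image. -/
theorem LinearMap.IsSymmetric.re_inner_self_of_idempotent {Q : E →ₗ[𝕜] E} (hQ : Q.IsSymmetric)
    (hidem : Q ∘ₗ Q = Q) (x : E) : RCLike.re (inner 𝕜 (Q x) x) = ‖Q x‖ ^ 2 := by
  rw [← inner_self_eq_norm_sq (𝕜 := 𝕜), ← hQ (Q x) x, ← LinearMap.comp_apply, hidem]

theorem LinearMap.IsSymmetric.isPositive_of_idempotent {Q : E →ₗ[𝕜] E} (hQ : Q.IsSymmetric)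
    (hidem : Q ∘ₗ Q = Q) : Q.IsPositive :=
  ⟨hQ, fun x => hQ.re_inner_self_of_idempotent hidem x ▸ sq_nonneg _⟩

/-- Jensen's inequality for the moments of a positive operator in a unit vector. -/
theorem LinearMap.IsPositive.re_inner_pow_le {T : E →ₗ[𝕜] E} (hT : T.IsPositive) {x : E}
    (hx : ‖x‖ = 1) (k : ℕ) :
    RCLike.re (inner 𝕜 (T x) x) ^ k ≤ RCLike.re (inner 𝕜 ((T ^ k) x) x) := by
  set a := RCLike.re (inner 𝕜 (T x) x) with ha
  have ha0 : 0 ≤ a := hT.re_inner_nonneg_left x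
  have hstep : ∀ k, a * RCLike.re (inner 𝕜 ((T ^ k) x) x)
      ≤ RCLike.re (inner 𝕜 ((T ^ (k + 1)) x) x) := by
    intro k
    induction k with
    | zero => simp [hx, ← ha]
    | succ k ih =>
      have hpos := (hT.pow k).re_inner_nonneg_left (T x - (a : 𝕜) • x)
      have h₁ : (T ^ k) (T x) = (T ^ (k + 1)) x := by rw [pow_succ, Module.End.mul_apply]
      have h₂ : ∀ y, inner 𝕜 y (T x) = inner 𝕜 (T y) x := fun y => (hT.isSymmetric y x).symm
      have h₃ : ∀ j, T ((T ^ j) x) = (T ^ (j + 1)) x := fun j => by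
        rw [pow_succ', Module.End.mul_apply]
      simp only [map_sub, map_smul, h₁, inner_sub_left, inner_sub_right, inner_smul_left,
        inner_smul_right, h₂, h₃, RCLike.conj_ofReal, RCLike.re_ofReal_mul] at hpos
      nlinarith [mul_le_mul_of_nonneg_left ih ha0]
  induction k with
  | zero => simp [hx]
  | succ k ih =>
    rw [pow_succ']
    exact (mul_le_mul_of_nonneg_left ih ha0).trans (hstep k)

end PositiveOperators

theorem sq_norm_sum_le_card_mul_sum_sq_norm {ι E : Type*} [SeminormedAddCommGroup E]
    (s : Finset ι) (f : ι → E) : ‖∑ i ∈ s, f i‖ ^ 2 ≤ #s * ∑ i ∈ s, ‖f i‖ ^ 2 :=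
  (pow_le_pow_left₀ (norm_nonneg _) (norm_sum_le s f) 2).trans sq_sum_le_card_mul_sum_sq

section SeqApply

variable {E : Type*} [NormedAddCommGroup E] [InnerProductSpace ℂ E] {n : ℕ}

theorem seqApply_snoc {t : ℕ} (P : Fin n → (E →ₗ[ℂ] E)) (iv : Fin t → Fin n) (i : Fin n) (ψ : E) :
    seqApply P (Fin.snoc iv i : Fin (t + 1) → Fin n) ψ = P i (seqApply P iv ψ) := by
  rw [seqApply, List.ofFn_succ', List.concat_eq_append, List.foldl_append]
  simp [seqApply]

theorem sum_fin_succ_eq_sum_snoc {M : Type*} [AddCommMonoid M] {t : ℕ}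
    (f : (Fin (t + 1) → Fin n) → M) :
    ∑ iv, f iv = ∑ i, ∑ iv : Fin t → Fin n, f (Fin.snoc iv i) := by
  rw [← (Fin.snocEquiv fun _ => Fin n).sum_comp, Fintype.sum_prod_type]
  rfl

theorem sum_seqApply (P : Fin n → (E →ₗ[ℂ] E)) (t : ℕ) (ψ : E) :
    ∑ iv : Fin t → Fin n, seqApply P iv ψ = ((∑ i, P i) ^ t) ψ := by
  induction t with
  | zero => simp [seqApply]
  | succ t ih =>
    simp_rw [sum_fin_succ_eq_sum_snoc, seqApply_snoc, ← map_sum, ih]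
    rw [pow_succ', Module.End.mul_apply, LinearMap.sum_apply]

/-- Cauchy-Schwarz over all but the last of the projections. -/
theorem re_inner_pow_le_sum_sq_norm_seqApply (P : Fin n → (E →ₗ[ℂ] E))
    (hproj : ∀ i, (P i) ∘ₗ (P i) = P i) (hsym : ∀ i, (P i).IsSymmetric) (s : ℕ) (ψ : E) :
    RCLike.re (inner ℂ (((∑ i, P i) ^ (2 * s + 1)) ψ) ψ)
      ≤ (n : ℝ) ^ s * ∑ iv : Fin (s + 1) → Fin n, ‖seqApply P iv ψ‖ ^ 2 := by
  have hS : (∑ i, P i).IsPositive :=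
    .sum _ fun i _ => (hsym i).isPositive_of_idempotent (hproj i)
  rw [show 2 * s + 1 = s + (1 + s) by ring, pow_add, pow_add, pow_one, Module.End.mul_apply,
    Module.End.mul_apply, hS.isSymmetric.pow s, LinearMap.sum_apply, sum_inner, map_sum,
    sum_fin_succ_eq_sum_snoc, mul_sum]
  refine sum_le_sum fun i _ => ?_
  rw [(hsym i).re_inner_self_of_idempotent (hproj i), ← sum_seqApply, map_sum]
  simpa [seqApply_snoc] using
    sq_norm_sum_le_card_mul_sum_sq_norm univ fun iv : Fin s → Fin n => P i (seqApply P iv ψ)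

end SeqApply

theorem extractor_success_probability
    {E : Type*} [NormedAddCommGroup E] [InnerProductSpace ℂ E] [FiniteDimensional ℂ E]
    {n t : ℕ} (hn : 0 < n) (ht : 0 < t)
    (P : Fin n → (E →ₗ[ℂ] E))
    (hproj : ∀ i, (P i) ∘ₗ (P i) = P i)
    (hsym : ∀ i, (P i).IsSymmetric)
    (ψ : E) (hψ : ‖ψ‖ = 1)
    (V : ℝ) (hV : V = (1 / (n : ℝ)) * ∑ i, ‖P i ψ‖ ^ 2) :
    (1 / (n : ℝ) ^ t) * ∑ iv : Fin t → Fin n, ‖seqApply P iv ψ‖ ^ 2 ≥ V ^ (2 * t - 1) ∧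
    ∀ c : ℝ, 0 < c → V ≥ 1 / c →
      (1 / (n : ℝ) ^ t) * ∑ iv : Fin t → Fin n, ‖seqApply P iv ψ‖ ^ 2
        ≥ (1 / c) ^ (2 * t - 1) := by
  have hn' : (0 : ℝ) < n := Nat.cast_pos.mpr hn
  have hS : (∑ i, P i).IsPositive :=
    .sum _ fun i _ => (hsym i).isPositive_of_idempotent (hproj i)
  have hnV : RCLike.re (inner ℂ ((∑ i, P i) ψ) ψ) = n * V := by
    rw [hV, LinearMap.sum_apply, sum_inner, map_sum]
    simp_rw [fun i => (hsym i).re_inner_self_of_idempotent (hproj i) ψ]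
    field_simp
  have hmain : (1 / (n : ℝ) ^ t) * ∑ iv : Fin t → Fin n, ‖seqApply P iv ψ‖ ^ 2
      ≥ V ^ (2 * t - 1) := by
    obtain ⟨s, rfl⟩ := Nat.exists_eq_succ_of_ne_zero ht.ne'
    have h := (hS.re_inner_pow_le hψ (2 * s + 1)).trans
      (re_inner_pow_le_sum_sq_norm_seqApply P hproj hsym s ψ)
    rw [hnV, mul_pow, show 2 * s + 1 = s + (s + 1) by ring, pow_add (n : ℝ), mul_assoc] at h
    rw [ge_iff_le, Nat.succ_eq_add_one, show 2 * (s + 1) - 1 = s + (s + 1) by lia,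
      one_div_mul_eq_div, le_div_iff₀' (by positivity)]
    exact le_of_mul_le_mul_left h (by positivity)
  exact ⟨hmain, fun c hc hVc =>
    (pow_le_pow_left₀ (by positivity) hVc (2 * t - 1)).trans hmain⟩
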